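/- Let M be a U_q(sl₂)-module, λ an integer, and v ∈ M a weight vector with t·v = q^λ v. Then f^(r) e^(s) v = Σ_{k=0}^{min(r,s)} [r - s - λ choose k]_q e^(s-k) f^(r-k) v, where [m choose k]_q denotes the Gaussian binomial coefficient [m]_q[m-1]_q⋯[m-k+1]_q/[k]_q!. -/

import Mathlib

noncomputable section

abbrev K : Type := RatFunc ℚ

def qq : K := RatFunc.X

/-- `x` is a rational function without pole at `q = 0`. -/
def RegA (x : K) : Prop :=
  ∃ f g : Polynomial ℚ, Polynomial.eval 0 g ≠ 0 ∧
    x = algebraMap (Polynomial ℚ) K f / algebraMap (Polynomial ℚ) K g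

/-- quantum integer `[n]_q` for `n : ℤ`. -/
def qint (n : ℤ) : K := (qq ^ n - qq ^ (-n)) / (qq - qq⁻¹)

/-- quantum factorial `[k]_q!`. -/
def qfac (k : ℕ) : K := ∏ j ∈ Finset.range k, qint ((j : ℤ) + 1)

/-- Gaussian binomial coefficient `[m choose k]_q`, `m : ℤ`, `k : ℕ`. -/
def qbinom (m : ℤ) (k : ℕ) : K := (∏ j ∈ Finset.range k, qint (m - (j : ℤ))) / qfac k

lemma qq_ne_zero : qq ≠ 0 := RatFunc.X_ne_zero

lemma qq_pow_ne_one {n : ℕ} (hn : n ≠ 0) : qq ^ n ≠ 1 := by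
  intro h
  have h1 : algebraMap (Polynomial ℚ) K (Polynomial.X ^ n) = algebraMap (Polynomial ℚ) K 1 := by
    rw [map_pow, map_one, RatFunc.algebraMap_X]
    exact h
  have h2 := congrArg Polynomial.natDegree (RatFunc.algebraMap_injective ℚ h1)
  simp only [Polynomial.natDegree_X_pow, Polynomial.natDegree_one] at h2
  exact hn h2

lemma qq_sub_inv_ne_zero : qq - qq⁻¹ ≠ 0 := by
  intro h
  apply qq_pow_ne_one two_ne_zero
  have h0 := qq_ne_zero
  field_simp at h
  linear_combination h

lemma qint_zero : qint 0 = 0 := by simp [qint]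

lemma qint_one : qint 1 = 1 := by
  simp only [qint, zpow_one, zpow_neg]
  exact div_self qq_sub_inv_ne_zero

lemma qint_neg (n : ℤ) : qint (-n) = -qint n := by
  simp only [qint, neg_neg]
  ring

lemma qint_natCast_add_one_ne_zero (n : ℕ) : qint ((n : ℤ) + 1) ≠ 0 := by
  refine div_ne_zero (fun h => ?_) qq_sub_inv_ne_zero
  apply qq_pow_ne_one (n := (n + 1) + (n + 1)) (by omega)
  rw [← Nat.cast_succ, zpow_neg, zpow_natCast] at h
  have h0 := pow_ne_zero (n + 1) qq_ne_zero
  rw [pow_add]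
  nth_rewrite 1 [sub_eq_zero.mp h]
  exact inv_mul_cancel₀ h0

lemma qfac_zero : qfac 0 = 1 := by simp [qfac]

lemma qfac_succ (n : ℕ) : qfac (n + 1) = qfac n * qint ((n : ℤ) + 1) :=
  Finset.prod_range_succ _ _

lemma qfac_ne_zero (n : ℕ) : qfac n ≠ 0 :=
  Finset.prod_ne_zero_iff.mpr fun j _ => qint_natCast_add_one_ne_zero j

lemma qint_mul_qint (a b k : ℤ) :
    qint a * qint b = qint (a - k) * qint (b - k) + qint k * qint (a + b - k) := by
  have h0 := qq_ne_zero
  have ha := zpow_ne_zero a h0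
  have hb := zpow_ne_zero b h0
  have hk := zpow_ne_zero k h0
  simp only [qint, div_mul_div_comm, ← add_div]
  congr 1
  simp only [neg_sub, zpow_neg, zpow_sub₀ h0, zpow_add₀ h0]
  field_simp
  ring

lemma qbinom_zero (m : ℤ) : qbinom m 0 = 1 := by simp [qbinom, qfac]

lemma qbinom_succ (m : ℤ) (k : ℕ) :
    qbinom m (k + 1) * qint ((k : ℤ) + 1) = qbinom m k * qint (m - k) := by
  have h1 := qint_natCast_add_one_ne_zero k
  have h2 := qfac_ne_zero k
  simp only [qbinom, Finset.prod_range_succ, qfac_succ]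
  field_simp

lemma qbinom_add_one_succ (m : ℤ) (k : ℕ) :
    qbinom (m + 1) (k + 1) * qint ((k : ℤ) + 1) = qbinom m k * qint (m + 1) := by
  have h1 := qint_natCast_add_one_ne_zero k
  have h2 := qfac_ne_zero k
  have h3 : ∏ j ∈ Finset.range (k + 1), qint (m + 1 - (j : ℤ)) =
      (∏ j ∈ Finset.range k, qint (m - (j : ℤ))) * qint (m + 1) := by
    rw [Finset.prod_range_succ']
    simp only [Nat.cast_add, Nat.cast_one, Nat.cast_zero, sub_zero, add_sub_add_right_eq_sub]
  simp only [qbinom, h3, qfac_succ]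
  field_simp

lemma qint_mul_qbinom_add_one_succ (m b : ℤ) (k : ℕ) :
    qint b * qbinom (m + 1) (k + 1) =
      qbinom m (k + 1) * qint (b - (k + 1)) + qbinom m k * qint (m + b - k) := by
  apply mul_right_cancel₀ (qint_natCast_add_one_ne_zero k)
  have h := qint_mul_qint (m + 1) b (k + 1)
  rw [show m + 1 - ((k : ℤ) + 1) = m - k by ring,
    show m + 1 + b - ((k : ℤ) + 1) = m + b - k by ring] at h
  linear_combination qint b * qbinom_add_one_succ m k + qbinom m k * h -
    qint (b - (k + 1)) * qbinom_succ m k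

section DividedPower

variable {M : Type*} [AddCommGroup M] [Module K M]

/-- The divided power `X^(n)`, extended by zero to negative exponents. -/
def dividedPow (X : Module.End K M) : ℤ → Module.End K M
  | Int.ofNat n => (qfac n)⁻¹ • X ^ n
  | Int.negSucc _ => 0

lemma dividedPow_natCast (X : Module.End K M) (n : ℕ) :
    dividedPow X n = (qfac n)⁻¹ • X ^ n := rfl

lemma dividedPow_of_neg (X : Module.End K M) {n : ℤ} (hn : n < 0) : dividedPow X n = 0 := by
  obtain ⟨k, rfl⟩ := Int.eq_negSucc_of_lt_zero hn
  rfl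

lemma apply_dividedPow (X : Module.End K M) (n : ℤ) (w : M) :
    X (dividedPow X n w) = qint (n + 1) • dividedPow X (n + 1) w := by
  rcases lt_trichotomy n (-1) with h | rfl | h
  · simp [dividedPow_of_neg X (show n < 0 by omega), dividedPow_of_neg X (show n + 1 < 0 by omega)]
  · simp [dividedPow_of_neg X (show (-1 : ℤ) < 0 by omega), qint_zero]
  · lift n to ℕ using by omega
    have h1 := qint_natCast_add_one_ne_zero n
    rw [← Nat.cast_succ, dividedPow_natCast, dividedPow_natCast]
    simp only [LinearMap.smul_apply, map_smul, smul_smul, Nat.succ_eq_add_one, qfac_succ,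
      pow_succ', Module.End.mul_apply, Nat.cast_add, Nat.cast_one]
    congr 1
    field_simp

variable {E F T Tinv : Module.End K M}

lemma weight_apply {X : Module.End K M} {a lam : ℤ} {v : M} (hX : T * X = qq ^ a • (X * T))
    (hv : T v = qq ^ lam • v) : T (X v) = qq ^ (lam + a) • X v := by
  have h := LinearMap.congr_fun hX v
  simp only [Module.End.mul_apply, LinearMap.smul_apply, hv, map_smul, smul_smul] at h
  rw [h, zpow_add₀ qq_ne_zero, mul_comm]

lemma weight_pow_apply {X : Module.End K M} {a lam : ℤ} {v : M} (hX : T * X = qq ^ a • (X * T))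
    (hv : T v = qq ^ lam • v) (n : ℕ) : T ((X ^ n) v) = qq ^ (lam + n * a) • (X ^ n) v := by
  induction n with
  | zero => simpa using hv
  | succ n ih =>
    rw [pow_succ', Module.End.mul_apply, weight_apply hX ih]
    congr 2
    push_cast
    ring

lemma weight_dividedPow_apply {X : Module.End K M} {a lam : ℤ} {v : M}
    (hX : T * X = qq ^ a • (X * T)) (hv : T v = qq ^ lam • v) (n : ℤ) :
    T (dividedPow X n v) = qq ^ (lam + n * a) • dividedPow X n v := by
  rcases lt_or_ge n 0 with h | h
  · simp [dividedPow_of_neg X h]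
  · lift n to ℕ using h
    rw [dividedPow_natCast, LinearMap.smul_apply, map_smul, weight_pow_apply hX hv, smul_comm]

lemma apply_F_apply_E (ht' : Tinv * T = 1)
    (hef : E * F - F * E = (qq - qq⁻¹)⁻¹ • (T - Tinv))
    {mu : ℤ} {w : M} (hw : T w = qq ^ mu • w) : F (E w) = E (F w) - qint mu • w := by
  have hinv : Tinv w = qq ^ (-mu) • w := by
    have h := LinearMap.congr_fun ht' w
    simp only [Module.End.mul_apply, hw, map_smul, Module.End.one_apply] at h
    rw [zpow_neg, eq_inv_smul_iff₀ (zpow_ne_zero _ qq_ne_zero), h]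
  have h := LinearMap.congr_fun hef w
  simp only [LinearMap.sub_apply, Module.End.mul_apply, LinearMap.smul_apply, hw, hinv,
    ← sub_smul, smul_smul] at h
  rw [qint, div_eq_inv_mul, ← h, sub_sub_cancel]

lemma apply_F_pow_E (ht' : Tinv * T = 1) (hte : T * E = qq ^ (2 : ℤ) • (E * T))
    (hef : E * F - F * E = (qq - qq⁻¹)⁻¹ • (T - Tinv)) (n : ℕ)
    {mu : ℤ} {w : M} (hw : T w = qq ^ mu • w) :
    F ((E ^ (n + 1)) w) =
      (E ^ (n + 1)) (F w) - (qint (n + 1) * qint (mu + n)) • (E ^ n) w := by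
  induction n generalizing mu w with
  | zero => simpa [qint_one] using apply_F_apply_E ht' hef hw
  | succ n ih =>
    have h := qint_mul_qint (n + 2) (mu + n + 1) (n + 1)
    rw [show (n : ℤ) + 2 - (n + 1) = 1 by ring, show mu + n + 1 - ((n : ℤ) + 1) = mu by ring,
      show (n : ℤ) + 2 + (mu + n + 1) - (n + 1) = mu + 2 + n by ring, qint_one, one_mul] at h
    rw [pow_succ, Module.End.mul_apply, ih (weight_apply hte hw), apply_F_apply_E ht' hef hw,
      map_sub, map_smul, ← Module.End.mul_apply (E ^ n) E w, ← pow_succ,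
      ← Module.End.mul_apply (E ^ (n + 1)) E, sub_sub, ← add_smul, ← h]
    push_cast
    ring_nf

lemma apply_F_dividedPow_E (ht' : Tinv * T = 1) (hte : T * E = qq ^ (2 : ℤ) • (E * T))
    (hef : E * F - F * E = (qq - qq⁻¹)⁻¹ • (T - Tinv)) (n : ℤ)
    {mu : ℤ} {w : M} (hw : T w = qq ^ mu • w) :
    F (dividedPow E n w) =
      dividedPow E n (F w) + qint (1 - n - mu) • dividedPow E (n - 1) w := by
  rcases lt_trichotomy n 0 with h | rfl | h
  · simp [dividedPow_of_neg E h, dividedPow_of_neg E (show n - 1 < 0 by omega)]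
  · rw [dividedPow_of_neg E (show (0 : ℤ) - 1 < 0 by omega), ← Nat.cast_zero, dividedPow_natCast]
    simp [qfac_zero]
  · obtain ⟨k, rfl⟩ : ∃ k : ℕ, n = (k + 1 : ℕ) := ⟨(n - 1).toNat, by omega⟩
    have h1 := qint_natCast_add_one_ne_zero k
    have h2 := qfac_ne_zero k
    rw [show ((k + 1 : ℕ) : ℤ) - 1 = (k : ℕ) by push_cast; ring, dividedPow_natCast,
      dividedPow_natCast, show 1 - ((k + 1 : ℕ) : ℤ) - mu = -(mu + k) by push_cast; ring, qint_neg]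
    simp only [LinearMap.smul_apply, map_smul, apply_F_pow_E ht' hte hef k hw, smul_add,
      smul_smul, sub_eq_add_neg, ← neg_smul]
    congr 2
    rw [qfac_succ]
    field_simp

lemma dividedPow_apply_dividedPow (ht' : Tinv * T = 1) (hte : T * E = qq ^ (2 : ℤ) • (E * T))
    (htf : T * F = qq ^ (-2 : ℤ) • (F * T))
    (hef : E * F - F * E = (qq - qq⁻¹)⁻¹ • (T - Tinv))
    {lam : ℤ} {v : M} (hv : T v = qq ^ lam • v) (r : ℕ) (s : ℤ) :
    dividedPow F r (dividedPow E s v) =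
      ∑ k ∈ Finset.range (r + 1),
        qbinom (r - s - lam) k • dividedPow E (s - k) (dividedPow F (r - k) v) := by
  induction r with
  | zero =>
    have h (X : Module.End K M) : dividedPow X 0 = 1 := by
      rw [← Nat.cast_zero, dividedPow_natCast, qfac_zero, inv_one, one_smul, pow_zero]
    simp [h, qbinom_zero]
  | succ r ih =>
    have hr := qint_natCast_add_one_ne_zero r
    apply smul_right_injective M hr
    simp only
    rw [Nat.cast_succ, ← apply_dividedPow, ih, map_sum, Finset.smul_sum]
    have step (k : ℕ) :
        F (qbinom (r - s - lam) k • dividedPow E (s - k) (dividedPow F (r - k) v)) =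
          (qbinom (r - s - lam) k * qint (r + 1 - k)) •
              dividedPow E (s - k) (dividedPow F (r + 1 - k) v) +
            (qbinom (r - s - lam) k * qint (r - s - lam + (r + 1) - k)) •
              dividedPow E (s - (k + 1)) (dividedPow F (r + 1 - (k + 1)) v) := by
      rw [map_smul, apply_F_dividedPow_E ht' hte hef _ (weight_dividedPow_apply htf hv _),
        apply_dividedPow, map_smul, smul_add, smul_smul, smul_smul]
      ring_nf
    have top : (qbinom (r - s - lam) (r + 1) * qint (r + 1 - (r + 1 : ℕ))) •
        dividedPow E (s - (r + 1 : ℕ)) (dividedPow F (r + 1 - (r + 1 : ℕ)) v) = 0 := by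
      simp [qint_zero]
    rw [Finset.sum_congr rfl fun k _ => step k, Finset.sum_add_distrib,
      ← add_zero (∑ k ∈ Finset.range (r + 1), (_ : M)), ← top, ← Finset.sum_range_succ,
      Finset.sum_range_succ', Finset.sum_range_succ' _ (r + 1), add_right_comm,
      ← Finset.sum_add_distrib]
    congr 1
    · refine Finset.sum_congr rfl fun k _ => ?_
      rw [smul_smul, show (r : ℤ) + 1 - s - lam = r - s - lam + 1 by ring,
        qint_mul_qbinom_add_one_succ, add_smul]
      push_cast
      rfl
    · simp [qbinom_zero]

end DividedPower

/-- For a `U_q(sl₂)`-module `M` and a weight vector `v` with `t·v = q^λ v`: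
`f^(r) e^(s) v = Σ_{k=0}^{min(r,s)} [r-s-λ choose k]_q e^(s-k) f^(r-k) v`. -/
theorem divided_power_commutation_on_weight_vector
    (M : Type*) [AddCommGroup M] [Module K M]
    (E F T Tinv : Module.End K M)
    (ht : T * Tinv = 1) (ht' : Tinv * T = 1)
    (hte : T * E = (qq ^ 2) • (E * T))
    (htf : T * F = (qq ^ (-2 : ℤ)) • (F * T))
    (hef : E * F - F * E = (qq - qq⁻¹)⁻¹ • (T - Tinv))
    (lam : ℤ) (v : M) (hv : T v = (qq ^ lam) • v)
    (r s : ℕ) :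
    ((qfac r)⁻¹ • F ^ r) (((qfac s)⁻¹ • E ^ s) v) =
      ∑ k ∈ Finset.range (min r s + 1),
        qbinom ((r : ℤ) - (s : ℤ) - lam) k •
          (((qfac (s - k))⁻¹ • E ^ (s - k)) (((qfac (r - k))⁻¹ • F ^ (r - k)) v)) := by
  have h := dividedPow_apply_dividedPow ht' (by exact_mod_cast hte) htf hef hv r s
  rw [dividedPow_natCast, dividedPow_natCast] at h
  rw [h]
  symm
  refine Finset.sum_subset_zero_on_sdiff (Finset.range_mono (by omega)) ?_ ?_
  · intro k hk
    simp only [Finset.mem_sdiff, Finset.mem_range] at hk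
    simp [dividedPow_of_neg E (show (s : ℤ) - k < 0 by omega)]
  · intro k hk
    rw [Finset.mem_range] at hk
    rw [← dividedPow_natCast, ← dividedPow_natCast, Nat.cast_sub (by omega),
      Nat.cast_sub (by omega)]
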